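/- Variance bound for Bonnet's gradient estimator: Let q = N(m,Σ) be a Gaussian with positive-definite covariance, let q_* = N(m_*,Σ_*) satisfy the stationarity conditions ∫ ∇U dq_* = 0 and ∫ ∇²U dq_* = Σ_*^{-1}, and let ψ be any coupling of q and q_*. Then ∫ ‖∇U(z) − ∫ ∇U dq_*‖² dq(z) ≤ 4L · ∫ D_U(x, x_*) dψ(x, x_*) + 2dL. -/

import Mathlib

open MeasureTheory Matrix Real
open scoped RealInnerProductSpace

noncomputable section

/-- `ℝ^d` as a Euclidean space. -/
abbrev Vec (d : ℕ) := EuclideanSpace ℝ (Fin d)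

/-- `d × d` real matrices. -/
abbrev Mat (d : ℕ) := Matrix (Fin d) (Fin d) ℝ

variable {d : ℕ}

/-- Matrix-vector product as a map on Euclidean space. -/
def matVec (A : Mat d) (x : Vec d) : Vec d :=
  (EuclideanSpace.equiv (Fin d) ℝ).symm (A.mulVec (EuclideanSpace.equiv (Fin d) ℝ x))

/-- The Gaussian measure `N(m, S)` on `ℝ^d` with mean `m` and covariance `S`,
defined via its density with respect to Lebesgue measure.  (For `S` positive
definite this is the usual Gaussian probability measure.) -/
def gaussian (m : Vec d) (S : Mat d) : Measure (Vec d) :=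
  volume.withDensity fun x =>
    ENNReal.ofReal (Real.sqrt (((2 * π) ^ d * S.det)⁻¹) *
      Real.exp (-⟪x - m, matVec S⁻¹ (x - m)⟫ / 2))

/-- The Hessian of `f : ℝ^d → ℝ` at `x`, as a `d × d` matrix. -/
def hess (f : Vec d → ℝ) (x : Vec d) : Mat d :=
  Matrix.of fun i j =>
    fderiv ℝ (fun y => fderiv ℝ f y (EuclideanSpace.single j 1)) x (EuclideanSpace.single i 1)

/-- Frobenius norm of a matrix. -/
def frobNorm (A : Mat d) : ℝ := Real.sqrt (∑ i, ∑ j, (A i j) ^ 2)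

/-- Squared Frobenius norm of a matrix. -/
def frobSq (A : Mat d) : ℝ := ∑ i, ∑ j, (A i j) ^ 2

/-- Jacobian of `g : ℝ^d → ℝ^d` at `x`: `(jacobian g x) i j = ∂ g_j / ∂ x_i`. -/
def jacobian (g : Vec d → Vec d) (x : Vec d) : Mat d :=
  Matrix.of fun i j => fderiv ℝ (fun y => g y j) x (EuclideanSpace.single i 1)

/-- Integral of the gradient of `U` against a measure. -/
def intGrad (U : Vec d → ℝ) (q : Measure (Vec d)) : Vec d := ∫ x, gradient U x ∂q

/-- Entrywise integral of the Hessian of `U` against a measure. -/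
def intHess (U : Vec d → ℝ) (q : Measure (Vec d)) : Mat d :=
  Matrix.of fun i j => ∫ x, hess U x i j ∂q

/-- The variational free energy of the Gaussian `N(m,S)`:
`F(m,Σ) = ∫ U dN(m,Σ) − (1/2)·log((2πe)^d · det Σ)`. -/
def freeEnergy (U : Vec d → ℝ) (m : Vec d) (S : Mat d) : ℝ :=
  (∫ x, U x ∂(gaussian m S)) - (1 / 2) * Real.log ((2 * π * Real.exp 1) ^ d * S.det)

/-- Bregman divergence of `U`: `D_U(x,y) = U(x) − U(y) − ⟨∇U(y), x − y⟩`. -/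
def bregman (U : Vec d → ℝ) (x y : Vec d) : ℝ := U x - U y - ⟪gradient U y, x - y⟫

/-- `ψ` is a coupling of `p` and `q`: a probability measure on the product whose
marginals are `p` and `q`. -/
def IsCoupling (ψ : Measure (Vec d × Vec d)) (p q : Measure (Vec d)) : Prop :=
  IsProbabilityMeasure ψ ∧ ψ.map Prod.fst = p ∧ ψ.map Prod.snd = q
lemma inner_matVec (A : Mat d) (x y : Vec d) : ⟪x, matVec A y⟫ = x.ofLp ⬝ᵥ A *ᵥ y.ofLp := by
  rw [EuclideanSpace.inner_eq_star_dotProduct, dotProduct_comm]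
  rfl

lemma matVec_eq_toEuclideanCLM (A : Mat d) (x : Vec d) :
    matVec A x = Matrix.toEuclideanCLM (𝕜 := ℝ) A x := rfl

lemma matVec_matVec (A B : Mat d) (x : Vec d) : matVec A (matVec B x) = matVec (A * B) x := by
  simp [matVec_eq_toEuclideanCLM]

lemma matVec_one (x : Vec d) : matVec (1 : Mat d) x = x := by
  simp [matVec]

@[fun_prop]
lemma continuous_matVec (A : Mat d) : Continuous (matVec A) :=
  (Matrix.toEuclideanCLM (𝕜 := ℝ) A).continuous

lemma inner_matVec_comm {A : Mat d} (hA : A.IsHermitian) (x y : Vec d) :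
    ⟪x, matVec A y⟫ = ⟪y, matVec A x⟫ := by
  have hAT : Aᵀ = A := by simpa [conjTranspose_eq_transpose_of_trivial] using hA.eq
  rw [inner_matVec, inner_matVec, dotProduct_mulVec, dotProduct_comm, ← mulVec_transpose, hAT]

lemma exists_pos_mul_sq_norm_le_inner_matVec {A : Mat d} (hA : A.PosDef) :
    ∃ c : ℝ, 0 < c ∧ ∀ x : Vec d, c * ‖x‖ ^ 2 ≤ ⟪x, matVec A x⟫ := by
  have hcont : ContinuousOn (fun x : Vec d => ⟪x, matVec A x⟫) (Metric.sphere 0 1) := by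
    fun_prop
  have hpos : ∀ x ∈ Metric.sphere (0 : Vec d) 1, (0 : ℝ) < ⟪x, matVec A x⟫ := by
    intro x hx
    rw [inner_matVec]
    have hx0 : x ≠ 0 := ne_zero_of_mem_unit_sphere ⟨x, hx⟩
    have := hA.dotProduct_mulVec_pos (x := x.ofLp) (by simpa using hx0)
    simpa using this
  obtain ⟨c, hc, hle⟩ := (isCompact_sphere (0 : Vec d) 1).exists_forall_le' hcont hpos
  refine ⟨c, hc, fun x => ?_⟩
  rcases eq_or_ne x 0 with rfl | hx
  · simp
  have hn : ‖x‖ ≠ 0 := norm_ne_zero_iff.mpr hx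
  have h := hle (‖x‖⁻¹ • x) (by simp [norm_smul, hn])
  rw [matVec_eq_toEuclideanCLM, map_smul, ← matVec_eq_toEuclideanCLM, inner_smul_left,
    inner_smul_right] at h
  simp only [conj_trivial] at h
  calc c * ‖x‖ ^ 2 ≤ (‖x‖⁻¹ * (‖x‖⁻¹ * ⟪x, matVec A x⟫)) * ‖x‖ ^ 2 := by gcongr
    _ = ⟪x, matVec A x⟫ := by field_simp

/-- The density of `gaussian m S` with respect to Lebesgue measure. -/
def gaussianDensity (m : Vec d) (S : Mat d) (x : Vec d) : ℝ :=
  Real.sqrt (((2 * π) ^ d * S.det)⁻¹) * Real.exp (-⟪x - m, matVec S⁻¹ (x - m)⟫ / 2)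

lemma gaussianDensity_nonneg (m : Vec d) (S : Mat d) (x : Vec d) : 0 ≤ gaussianDensity m S x := by
  unfold gaussianDensity; positivity

@[fun_prop]
lemma continuous_gaussianDensity (m : Vec d) (S : Mat d) : Continuous (gaussianDensity m S) := by
  unfold gaussianDensity; fun_prop

lemma gaussian_eq_withDensity (m : Vec d) (S : Mat d) :
    gaussian m S = volume.withDensity fun x => ENNReal.ofReal (gaussianDensity m S x) := rfl

lemma integrable_gaussian_iff {m : Vec d} {S : Mat d} {f : Vec d → ℝ} :
    Integrable f (gaussian m S) ↔ Integrable (fun x => f x * gaussianDensity m S x) := by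
  rw [gaussian_eq_withDensity, integrable_withDensity_iff_integrable_smul₀' (by fun_prop) (by simp)]
  simp [ENNReal.toReal_ofReal, gaussianDensity_nonneg, mul_comm]

lemma integral_gaussian_eq (m : Vec d) (S : Mat d) (f : Vec d → ℝ) :
    ∫ x, f x ∂(gaussian m S) = ∫ x, f x * gaussianDensity m S x := by
  rw [gaussian_eq_withDensity,
    integral_withDensity_eq_integral_toReal_smul₀ (by fun_prop) (by simp)]
  simp [ENNReal.toReal_ofReal, gaussianDensity_nonneg, mul_comm]

lemma integrable_exp_neg_mul_sq_norm {b : ℝ} (hb : 0 < b) :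
    Integrable (fun x : Vec d => Real.exp (-b * ‖x‖ ^ 2)) := by
  have h := (GaussianFourier.integrable_cexp_neg_mul_sq_norm_add (V := Vec d) (b := (b : ℂ))
    (by simpa using hb) 0 0).norm
  refine h.congr (Filter.Eventually.of_forall fun x => ?_)
  simp [Complex.norm_exp, ← Complex.ofReal_pow]

lemma integrable_gaussian_of_quadratic_growth {m : Vec d} {S : Mat d} (hS : S.PosDef)
    {f : Vec d → ℝ} (hf : Continuous f) {C : ℝ} (hC : ∀ x, |f x| ≤ C * (1 + ‖x - m‖ ^ 2)) :
    Integrable f (gaussian m S) := by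
  obtain ⟨c, hc, hle⟩ := exists_pos_mul_sq_norm_le_inner_matVec hS.inv
  rw [integrable_gaussian_iff]
  set Z := Real.sqrt (((2 * π) ^ d * S.det)⁻¹)
  have hint := ((integrable_exp_neg_mul_sq_norm (d := d) (b := c / 4)
    (by positivity)).comp_sub_right m).const_mul (C * Z * (1 + 4 / c))
  refine hint.mono' (by fun_prop) (Filter.Eventually.of_forall fun x => ?_)
  have hC0 : 0 ≤ C := by simpa using (abs_nonneg _).trans (hC m)
  have hexp : 1 + ‖x - m‖ ^ 2 ≤ (1 + 4 / c) * Real.exp (c / 4 * ‖x - m‖ ^ 2) := by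
    have h1 := Real.add_one_le_exp (c / 4 * ‖x - m‖ ^ 2)
    have h2 : 0 ≤ c / 4 * ‖x - m‖ ^ 2 := by positivity
    have h3 : ‖x - m‖ ^ 2 = 4 / c * (c / 4 * ‖x - m‖ ^ 2) := by field_simp
    have h4 : ‖x - m‖ ^ 2 ≤ 4 / c * Real.exp (c / 4 * ‖x - m‖ ^ 2) := by
      conv_lhs => rw [h3]
      gcongr
      linarith
    linarith
  rw [Real.norm_eq_abs, abs_mul, abs_of_nonneg (gaussianDensity_nonneg m S x)]
  calc |f x| * gaussianDensity m S x
      ≤ (C * ((1 + 4 / c) * Real.exp (c / 4 * ‖x - m‖ ^ 2))) *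
        (Z * Real.exp (-(c * ‖x - m‖ ^ 2) / 2)) := by
        unfold gaussianDensity
        gcongr
        · exact (hC x).trans (by gcongr)
        · exact hle _
    _ = C * Z * (1 + 4 / c) *
        (Real.exp (c / 4 * ‖x - m‖ ^ 2) * Real.exp (-(c * ‖x - m‖ ^ 2) / 2)) := by ring
    _ = _ := by rw [← Real.exp_add]; ring_nf

lemma hasLineDerivAt_gaussianDensity (m : Vec d) {S : Mat d} (hS : S.PosDef) (x w : Vec d) :
    HasLineDerivAt ℝ (gaussianDensity m S) (-(⟪x - m, w⟫ * gaussianDensity m S x)) x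
      (matVec S w) := by
  have hy : HasDerivAt (fun t : ℝ => x + t • matVec S w - m) (matVec S w) 0 := by
    simpa using (((hasDerivAt_id (0 : ℝ)).smul_const (matVec S w)).const_add x).sub_const m
  have hB : HasDerivAt (fun t : ℝ => matVec S⁻¹ (x + t • matVec S w - m)) w 0 := by
    have h := (Matrix.toEuclideanCLM (𝕜 := ℝ) S⁻¹).hasFDerivAt.comp_hasDerivAt (0 : ℝ) hy
    rw [← matVec_eq_toEuclideanCLM, matVec_matVec, Matrix.nonsing_inv_mul _ hS.det_pos.ne'.isUnit,
      matVec_one] at h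
    exact h
  have h := (((hy.inner ℝ hB).neg.div_const 2).exp).const_mul
    (Real.sqrt (((2 * π) ^ d * S.det)⁻¹))
  have hsymm : ⟪matVec S w, matVec S⁻¹ (x - m)⟫ = ⟪x - m, w⟫ := by
    rw [inner_matVec_comm hS.inv.isHermitian, matVec_matVec,
      Matrix.nonsing_inv_mul _ hS.det_pos.ne'.isUnit, matVec_one]
  refine h.congr_deriv ?_
  simp only [gaussianDensity, zero_smul, add_zero, hsymm, Pi.neg_apply]
  ring

/-- **Stein's identity** for Lipschitz functions. -/
lemma integral_mul_inner_gaussian {m : Vec d} {S : Mat d} (hS : S.PosDef) {f : Vec d → ℝ}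
    (hf : ContDiff ℝ 1 f) {K : NNReal} (hK : LipschitzWith K f) (w : Vec d) :
    ∫ x, f x * ⟪x - m, w⟫ ∂(gaussian m S) = ∫ x, fderiv ℝ f x (matVec S w) ∂(gaussian m S) := by
  have hfc : Continuous f := hf.continuous
  have hgrow : ∀ x, |f x| ≤ |f m| + K * ‖x - m‖ := fun x => by
    have h := hK.dist_le_mul x m
    rw [Real.dist_eq, dist_eq_norm] at h
    have := abs_sub_abs_le_abs_sub (f x) (f m)
    linarith
  have hlin : ∀ x, ‖x - m‖ ≤ 1 + ‖x - m‖ ^ 2 := fun x => by nlinarith [sq_nonneg (‖x - m‖ - 1)]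
  have hK0 : (0 : ℝ) ≤ K := K.coe_nonneg
  have h1 : Integrable (fun x => fderiv ℝ f x (matVec S w)) (gaussian m S) := by
    refine integrable_gaussian_of_quadratic_growth hS
      ((hf.continuous_fderiv (by norm_num)).clm_apply continuous_const)
      (C := K * ‖matVec S w‖) fun x => ?_
    calc |fderiv ℝ f x (matVec S w)| ≤ ‖fderiv ℝ f x‖ * ‖matVec S w‖ :=
          (fderiv ℝ f x).le_opNorm _
      _ ≤ K * ‖matVec S w‖ := by gcongr; exact norm_fderiv_le_of_lipschitz ℝ hK
      _ ≤ _ := le_mul_of_one_le_right (by positivity) (by nlinarith [sq_nonneg ‖x - m‖])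
  have h2 : Integrable (fun x => f x * ⟪x - m, w⟫) (gaussian m S) := by
    refine integrable_gaussian_of_quadratic_growth hS (by fun_prop)
      (C := (|f m| + K) * ‖w‖) fun x => ?_
    calc |f x * ⟪x - m, w⟫| ≤ (|f m| + K * ‖x - m‖) * (‖x - m‖ * ‖w‖) := by
          rw [abs_mul]
          exact mul_le_mul (hgrow x) (abs_real_inner_le_norm _ _) (abs_nonneg _) (by positivity)
      _ = (|f m| * ‖x - m‖ + K * ‖x - m‖ ^ 2) * ‖w‖ := by ring
      _ ≤ (|f m| * (1 + ‖x - m‖ ^ 2) + K * (1 + ‖x - m‖ ^ 2)) * ‖w‖ := by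
          gcongr
          · exact hlin x
          · linarith
      _ = _ := by ring
  have h3 : Integrable f (gaussian m S) := by
    refine integrable_gaussian_of_quadratic_growth hS hfc (C := |f m| + K) fun x => ?_
    nlinarith [hgrow x, mul_le_mul_of_nonneg_left (hlin x) hK0,
      mul_nonneg (abs_nonneg (f m)) (sq_nonneg ‖x - m‖)]
  rw [integrable_gaussian_iff] at h1 h2 h3
  have key := integral_bilinear_hasLineDerivAt_right_eq_neg_left_of_integrable
    (μ := (volume : Measure (Vec d))) (f := f) (f' := fun x => fderiv ℝ f x (matVec S w))
    (g := gaussianDensity m S) (g' := fun x => -(⟪x - m, w⟫ * gaussianDensity m S x))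
    (v := matVec S w) (B := ContinuousLinearMap.mul ℝ ℝ) h1
    (by simpa [mul_assoc] using h2) h3
    (fun x _ => (hf.differentiable (by norm_num) x).hasFDerivAt.hasLineDerivAt _)
    (fun x _ => hasLineDerivAt_gaussianDensity m hS x w)
  rw [integral_gaussian_eq, integral_gaussian_eq]
  simpa [integral_neg, mul_assoc] using key

lemma add_le_of_deriv2_nonneg {φ φ' φ'' : ℝ → ℝ} (h1 : ∀ t, HasDerivAt φ (φ' t) t)
    (h2 : ∀ t, HasDerivAt φ' (φ'' t) t) (h3 : ∀ t, 0 ≤ φ'' t) : φ 0 + φ' 0 ≤ φ 1 := by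
  obtain ⟨c, hc, hslope⟩ := exists_hasDerivAt_eq_slope φ φ' zero_lt_one
    (fun t _ => (h1 t).continuousAt.continuousWithinAt) fun t _ => h1 t
  have hmono : Monotone φ' := monotone_of_deriv_nonneg (fun t => (h2 t).differentiableAt)
    fun t => (h2 t).deriv ▸ h3 t
  have := hmono hc.1.le
  simp only [sub_zero, div_one] at hslope
  linarith

lemma inner_gradient {U : Vec d → ℝ} (x v : Vec d) : ⟪gradient U x, v⟫ = fderiv ℝ U x v :=
  InnerProductSpace.toDual_symm_apply

lemma continuous_gradient {U : Vec d → ℝ} (hU : ContDiff ℝ 2 U) : Continuous (gradient U) :=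
  (InnerProductSpace.toDual ℝ (Vec d)).symm.continuous.comp (hU.continuous_fderiv (by norm_num))

lemma hasFDerivAt_fderiv_apply {U : Vec d → ℝ} (hU : ContDiff ℝ 2 U) (x w : Vec d) :
    HasFDerivAt (fun y => fderiv ℝ U y w) ((fderiv ℝ (fderiv ℝ U) x).flip w) x := by
  have h : DifferentiableAt ℝ (fderiv ℝ U) x :=
    (hU.fderiv_right (m := 1) (by norm_num)).differentiable (by norm_num) x
  simpa using h.hasFDerivAt.clm_apply (hasFDerivAt_const w x)

lemma fderiv_fderiv_eq_dotProduct_hess {U : Vec d → ℝ} (hU : ContDiff ℝ 2 U) (x v w : Vec d) :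
    fderiv ℝ (fderiv ℝ U) x v w = v.ofLp ⬝ᵥ hess U x *ᵥ w.ofLp := by
  have hH : ∀ i j, hess U x i j =
      fderiv ℝ (fderiv ℝ U) x (EuclideanSpace.single i 1) (EuclideanSpace.single j 1) :=
    fun i j => by simp [hess, (hasFDerivAt_fderiv_apply hU x _).fderiv]
  have hsum : ∀ u : Vec d, u = ∑ i, u i • EuclideanSpace.single i (1 : ℝ) := fun u => by
    simpa using ((EuclideanSpace.basisFun (Fin d) ℝ).sum_repr u).symm
  conv_lhs => rw [hsum v, hsum w]
  simp [dotProduct, mulVec, hH, Finset.mul_sum, mul_comm, mul_left_comm]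
  exact Finset.sum_comm

lemma hasDerivAt_comp_line {U : Vec d → ℝ} (hU : ContDiff ℝ 2 U)
    (y v : Vec d) (t : ℝ) :
    HasDerivAt (fun t : ℝ => U (y + t • v)) (fderiv ℝ U (y + t • v) v) t := by
  have hl : HasDerivAt (fun t : ℝ => y + t • v) v t := by
    simpa using ((hasDerivAt_id t).smul_const v).const_add y
  exact (hU.differentiable (by norm_num) (y + t • v)).hasFDerivAt.comp_hasDerivAt t hl

lemma hasDerivAt_fderiv_comp_line {U : Vec d → ℝ} (hU : ContDiff ℝ 2 U)
    (y v : Vec d) (t : ℝ) :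
    HasDerivAt (fun t : ℝ => fderiv ℝ U (y + t • v) v)
      (fderiv ℝ (fderiv ℝ U) (y + t • v) v v) t := by
  have hl : HasDerivAt (fun t : ℝ => y + t • v) v t := by
    simpa using ((hasDerivAt_id t).smul_const v).const_add y
  exact (hasFDerivAt_fderiv_apply hU (y + t • v) v).comp_hasDerivAt t hl

lemma bregman_nonneg {U : Vec d → ℝ} (hU : ContDiff ℝ 2 U)
    (hlo : ∀ x v, 0 ≤ fderiv ℝ (fderiv ℝ U) x v v) (x y : Vec d) :
    0 ≤ bregman U x y := by
  have h := add_le_of_deriv2_nonneg (hasDerivAt_comp_line hU y (x - y))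
    (hasDerivAt_fderiv_comp_line hU y (x - y)) fun t => hlo _ _
  simp only [zero_smul, add_zero, one_smul, add_sub_cancel] at h
  rw [bregman, inner_gradient]
  linarith

lemma bregman_le {U : Vec d → ℝ} (hU : ContDiff ℝ 2 U)
    {L : ℝ} (hhi : ∀ x v, fderiv ℝ (fderiv ℝ U) x v v ≤ L * ‖v‖ ^ 2) (x y : Vec d) :
    bregman U x y ≤ L / 2 * ‖x - y‖ ^ 2 := by
  set c := L * ‖x - y‖ ^ 2 with hc
  have hq1 : ∀ t : ℝ, HasDerivAt (fun t : ℝ => c / 2 * t ^ 2) (c * t) t := fun t =>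
    ((hasDerivAt_pow 2 t).const_mul (c / 2)).congr_deriv (by simp; ring)
  have hq2 : ∀ t : ℝ, HasDerivAt (fun t : ℝ => c * t) c t := fun t => by
    simpa using (hasDerivAt_id t).const_mul c
  have h := add_le_of_deriv2_nonneg
    (fun t => (hq1 t).sub (hasDerivAt_comp_line hU y (x - y) t))
    (fun t => (hq2 t).sub (hasDerivAt_fderiv_comp_line hU y (x - y) t))
    fun t => sub_nonneg.mpr (hhi _ _)
  simp only [Pi.sub_apply, zero_smul, add_zero, one_smul, add_sub_cancel] at h
  rw [bregman, inner_gradient]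
  linarith

lemma sq_norm_gradient_sub_le {U : Vec d → ℝ} (hU : ContDiff ℝ 2 U)
    {L : ℝ} (hL : 0 < L)
    (hlo : ∀ x v, 0 ≤ fderiv ℝ (fderiv ℝ U) x v v)
    (hhi : ∀ x v, fderiv ℝ (fderiv ℝ U) x v v ≤ L * ‖v‖ ^ 2) (x y : Vec d) :
    ‖gradient U x - gradient U y‖ ^ 2 ≤ 2 * L * bregman U x y := by
  set w := gradient U x - gradient U y with hw
  have h1 := bregman_nonneg hU hlo (x - L⁻¹ • w) y
  have h2 := bregman_le hU hhi (x - L⁻¹ • w) x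
  have e1 : x - L⁻¹ • w - x = -(L⁻¹ • w) := by abel
  have e2 : x - L⁻¹ • w - y = (x - y) - L⁻¹ • w := by abel
  have e3 : ‖w‖ ^ 2 = ⟪gradient U x, w⟫ - ⟪gradient U y, w⟫ := by
    rw [← inner_sub_left, ← hw, real_inner_self_eq_norm_sq]
  rw [bregman, e2, inner_sub_right, inner_smul_right] at h1
  rw [bregman, e1, inner_neg_right, inner_smul_right, norm_neg, norm_smul, norm_inv,
    Real.norm_of_nonneg hL.le] at h2
  have h3 : L / 2 * (L⁻¹ * ‖w‖) ^ 2 = L⁻¹ * ‖w‖ ^ 2 / 2 := by field_simp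
  have h4 : L⁻¹ * ‖w‖ ^ 2 = L⁻¹ * ⟪gradient U x, w⟫ - L⁻¹ * ⟪gradient U y, w⟫ := by
    rw [e3]; ring
  have h5 : L⁻¹ * ‖w‖ ^ 2 / 2 ≤ bregman U x y := by
    rw [bregman]; linarith
  calc ‖w‖ ^ 2 = 2 * L * (L⁻¹ * ‖w‖ ^ 2 / 2) := by field_simp
    _ ≤ _ := by gcongr

lemma gradient_cocoercive {U : Vec d → ℝ} (hU : ContDiff ℝ 2 U)
    {L : ℝ} (hL : 0 < L)
    (hlo : ∀ x v, 0 ≤ fderiv ℝ (fderiv ℝ U) x v v)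
    (hhi : ∀ x v, fderiv ℝ (fderiv ℝ U) x v v ≤ L * ‖v‖ ^ 2) (x y : Vec d) :
    ‖gradient U x - gradient U y‖ ^ 2 ≤ L * ⟪gradient U x - gradient U y, x - y⟫ := by
  have h1 := sq_norm_gradient_sub_le hU hL hlo hhi x y
  have h2 := sq_norm_gradient_sub_le hU hL hlo hhi y x
  rw [norm_sub_rev] at h2
  have h3 : bregman U x y + bregman U y x = ⟪gradient U x - gradient U y, x - y⟫ := by
    rw [bregman, bregman, inner_sub_left, ← neg_sub x y, inner_neg_right]
    ring
  rw [← h3]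
  linarith

lemma lipschitzWith_gradient {U : Vec d → ℝ} (hU : ContDiff ℝ 2 U)
    {L : ℝ} (hL : 0 < L)
    (hlo : ∀ x v, 0 ≤ fderiv ℝ (fderiv ℝ U) x v v)
    (hhi : ∀ x v, fderiv ℝ (fderiv ℝ U) x v v ≤ L * ‖v‖ ^ 2) :
    LipschitzWith ⟨L, hL.le⟩ (gradient U) := by
  refine LipschitzWith.of_dist_le_mul fun x y => ?_
  rw [dist_eq_norm, dist_eq_norm]
  change _ ≤ L * _
  rcases (norm_nonneg (gradient U x - gradient U y)).eq_or_lt with h0 | h0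
  · rw [← h0]; positivity
  have h := (gradient_cocoercive hU hL hlo hhi x y).trans
    (mul_le_mul_of_nonneg_left (real_inner_le_norm _ _) hL.le)
  refine le_of_mul_le_mul_left ?_ h0
  linarith

lemma continuous_bregman {U : Vec d → ℝ} (hU : ContDiff ℝ 2 U) :
    Continuous fun p : Vec d × Vec d => bregman U p.1 p.2 := by
  have h1 := hU.continuous
  have h2 := continuous_gradient hU
  unfold bregman
  fun_prop

lemma integrable_sq_norm_of_lipschitzWith {m a : Vec d} {S : Mat d} (hS : S.PosDef)
    {g : Vec d → Vec d} {K : NNReal} (hg : LipschitzWith K g) :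
    Integrable (fun x => ‖g x - a‖ ^ 2) (gaussian m S) := by
  have hgc := hg.continuous
  refine integrable_gaussian_of_quadratic_growth hS (by fun_prop)
    (C := 2 * ‖g m - a‖ ^ 2 + 2 * K ^ 2) fun x => ?_
  have h1 := hg.dist_le_mul x m
  rw [dist_eq_norm, dist_eq_norm] at h1
  have h2 : ‖g x - a‖ ≤ ‖g m - a‖ + K * ‖x - m‖ := by
    calc ‖g x - a‖ = ‖(g m - a) + (g x - g m)‖ := by congr 1; abel
      _ ≤ _ := (norm_add_le _ _).trans (by gcongr)
  rw [abs_of_nonneg (by positivity)]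
  have h3 : ‖g x - a‖ ^ 2 ≤ (‖g m - a‖ + K * ‖x - m‖) ^ 2 := by gcongr
  have h4 : (0 : ℝ) ≤ (K : ℝ) ^ 2 := by positivity
  nlinarith [sq_nonneg (‖g m - a‖ - K * ‖x - m‖),
    mul_nonneg (sq_nonneg ‖g m - a‖) (sq_nonneg ‖x - m‖)]

lemma integral_inner_sub_mean_gaussian (m w : Vec d) {S : Mat d} (hS : S.PosDef) :
    ∫ x, ⟪w, x - m⟫ ∂(gaussian m S) = 0 := by
  have h := integral_mul_inner_gaussian (m := m) hS (f := fun _ => 1) contDiff_const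
    (LipschitzWith.const (1 : ℝ)) w
  simpa [real_inner_comm] using h

lemma integral_inner_gradient_gaussian {U : Vec d → ℝ} (hU : ContDiff ℝ 2 U) {K : NNReal}
    (hK : LipschitzWith K (gradient U)) {m : Vec d} {S : Mat d} (hS : S.PosDef) :
    ∫ x, ⟪gradient U x, x - m⟫ ∂(gaussian m S) = (S * intHess U (gaussian m S)).trace := by
  have hgc := continuous_gradient hU
  set e : Fin d → Vec d := fun i => EuclideanSpace.single i (1 : ℝ) with he
  have hne : ∀ i, ‖e i‖ = 1 := fun i => by simp [he]
  have hf : ∀ i, ContDiff ℝ 1 fun x => fderiv ℝ U x (e i) := fun i =>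
    (hU.fderiv_right (m := 1) (by norm_num)).clm_apply contDiff_const
  have hL : ∀ i, LipschitzWith K fun x => fderiv ℝ U x (e i) := fun i => by
    refine LipschitzWith.of_dist_le_mul fun x y => ?_
    rw [← inner_gradient, ← inner_gradient, Real.dist_eq, ← inner_sub_left]
    calc _ ≤ ‖gradient U x - gradient U y‖ * ‖e i‖ := abs_real_inner_le_norm _ _
      _ = dist (gradient U x) (gradient U y) := by rw [hne, mul_one, dist_eq_norm]
      _ ≤ _ := hK.dist_le_mul x y
  have hexpand : ∀ x, ⟪gradient U x, x - m⟫ = ∑ i, fderiv ℝ U x (e i) * ⟪x - m, e i⟫ := by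
    intro x
    rw [← (EuclideanSpace.basisFun (Fin d) ℝ).sum_inner_mul_inner]
    refine Finset.sum_congr rfl fun i _ => ?_
    rw [EuclideanSpace.basisFun_apply, inner_gradient, real_inner_comm]
  have hint : ∀ i, Integrable (fun x => fderiv ℝ U x (e i) * ⟪x - m, e i⟫) (gaussian m S) := by
    intro i
    have h1 := integrable_sq_norm_of_lipschitzWith (m := m) (a := 0) hS hK
    have h2 := integrable_sq_norm_of_lipschitzWith (m := m) (a := m) hS LipschitzWith.id
    refine (h1.add h2).mono' ?_ (Filter.Eventually.of_forall fun x => ?_)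
    · exact ((hf i).continuous.mul (by fun_prop)).aestronglyMeasurable
    · have b1 := abs_real_inner_le_norm (gradient U x) (e i)
      have b2 := abs_real_inner_le_norm (x - m) (e i)
      rw [hne, mul_one] at b1 b2
      rw [← inner_gradient, Real.norm_eq_abs, abs_mul]
      have b3 := mul_le_mul b1 b2 (abs_nonneg _) (norm_nonneg _)
      simp only [Pi.add_apply, sub_zero, id]
      nlinarith [sq_nonneg (‖gradient U x‖ - ‖x - m‖), sq_nonneg ‖gradient U x‖,
        sq_nonneg ‖x - m‖]
  have hhess : ∀ i j, Integrable (fun x => hess U x j i) (gaussian m S) := by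
    intro i j
    refine integrable_gaussian_of_quadratic_growth hS (C := K)
      (((hf i).continuous_fderiv (by norm_num)).clm_apply continuous_const) fun x => ?_
    calc |hess U x j i| ≤ ‖fderiv ℝ (fun y => fderiv ℝ U y (e i)) x‖ * ‖e j‖ :=
          (fderiv ℝ (fun y => fderiv ℝ U y (e i)) x).le_opNorm (e j)
      _ ≤ K := by rw [hne, mul_one]; exact norm_fderiv_le_of_lipschitz ℝ (hL i)
      _ ≤ _ := le_mul_of_one_le_right K.coe_nonneg (by nlinarith [sq_nonneg ‖x - m‖])
  have hcol : ∀ i, matVec S (e i) = ∑ j, S i j • e j := by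
    intro i
    ext k
    have hsymm : S k i = S i k := by simpa using hS.isHermitian.apply i k
    have hk : matVec S (e i) k = S k i := by
      change (S *ᵥ Pi.single i 1) k = S k i
      simp
    rw [hk, hsymm]
    simp [he, Finset.sum_apply, Pi.single_apply]
  have hstein : ∀ i, ∫ x, fderiv ℝ U x (e i) * ⟪x - m, e i⟫ ∂(gaussian m S) =
      ∑ j, S i j * intHess U (gaussian m S) j i := by
    intro i
    rw [integral_mul_inner_gaussian hS (hf i) (hL i)]
    simp only [hcol, map_sum, map_smul, smul_eq_mul]
    refine (integral_finsetSum _ fun j _ => (hhess i j).const_mul (S i j)).trans ?_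
    exact Finset.sum_congr rfl fun j _ => integral_const_mul _ _
  simp only [hexpand]
  rw [integral_finsetSum _ fun i _ => hint i]
  simp only [hstein, Matrix.trace, Matrix.diag, Matrix.mul_apply]

lemma integral_sq_norm_gradient_le {U : Vec d → ℝ} (hU : ContDiff ℝ 2 U) {L : ℝ} (hL : 0 < L)
    (hlo : ∀ x v, 0 ≤ fderiv ℝ (fderiv ℝ U) x v v)
    (hhi : ∀ x v, fderiv ℝ (fderiv ℝ U) x v v ≤ L * ‖v‖ ^ 2)
    {m : Vec d} {S : Mat d} (hS : S.PosDef) [IsProbabilityMeasure (gaussian m S)]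
    (hgrad : intGrad U (gaussian m S) = 0) (hhess : intHess U (gaussian m S) = S⁻¹) :
    ∫ x, ‖gradient U x‖ ^ 2 ∂(gaussian m S) ≤ L * d := by
  have hK := lipschitzWith_gradient hU hL hlo hhi
  have hgc := continuous_gradient hU
  have h1 : Integrable (fun x => ‖gradient U x‖ ^ 2) (gaussian m S) := by
    simpa using integrable_sq_norm_of_lipschitzWith (m := m) (a := 0) hS hK
  have h2 := integrable_sq_norm_of_lipschitzWith (m := m) (a := m) hS LipschitzWith.id
  have hg : Integrable (gradient U) (gaussian m S) := by
    refine (h1.add (integrable_const 1)).mono' hgc.aestronglyMeasurable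
      (Filter.Eventually.of_forall fun x => ?_)
    simp only [Pi.add_apply]
    nlinarith [sq_nonneg (‖gradient U x‖ - 1)]
  have hx : Integrable (fun x => x - m) (gaussian m S) := by
    refine (h2.add (integrable_const 1)).mono' (by fun_prop)
      (Filter.Eventually.of_forall fun x => ?_)
    simp only [Pi.add_apply, id]
    nlinarith [sq_nonneg (‖x - m‖ - 1)]
  have hgx : Integrable (fun x => ⟪gradient U x, x - m⟫) (gaussian m S) := by
    refine (h1.add h2).mono' (by fun_prop) (Filter.Eventually.of_forall fun x => ?_)
    have := abs_real_inner_le_norm (gradient U x) (x - m)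
    simp only [Pi.add_apply, id, Real.norm_eq_abs]
    nlinarith [sq_nonneg (‖gradient U x‖ - ‖x - m‖), sq_nonneg ‖gradient U x‖,
      sq_nonneg ‖x - m‖]
  have htrace : ∫ x, ⟪gradient U x, x - m⟫ ∂(gaussian m S) = d := by
    rw [integral_inner_gradient_gaussian hU hK hS, hhess,
      Matrix.mul_nonsing_inv _ hS.det_pos.ne'.isUnit]
    simp
  have hzero : ∫ x, ⟪gradient U m, gradient U x⟫ ∂(gaussian m S) = 0 := by
    rw [integral_inner hg]
    simp only [intGrad] at hgrad
    rw [hgrad, inner_zero_right]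
  have hga := hg.const_inner (𝕜 := ℝ) (gradient U m)
  have hxa := hx.const_inner (𝕜 := ℝ) (gradient U m)
  calc ∫ x, ‖gradient U x‖ ^ 2 ∂(gaussian m S)
      ≤ ∫ x, (2 * ⟪gradient U m, gradient U x⟫ + (L * ⟪gradient U x, x - m⟫
          - L * ⟪gradient U m, x - m⟫)) ∂(gaussian m S) := by
        refine integral_mono h1 ((hga.const_mul 2).add ((hgx.const_mul L).sub (hxa.const_mul L)))
          fun x => ?_
        have h := gradient_cocoercive hU hL hlo hhi x m
        rw [norm_sub_sq_real, inner_sub_left, real_inner_comm] at h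
        nlinarith [sq_nonneg ‖gradient U m‖]
    _ = L * d := by
        rw [integral_add (hga.const_mul 2)
            (g := fun x => L * ⟪gradient U x, x - m⟫ - L * ⟪gradient U m, x - m⟫)
            ((hgx.const_mul L).sub (hxa.const_mul L)),
          integral_sub (hgx.const_mul L) (hxa.const_mul L), integral_const_mul,
          integral_const_mul, integral_const_mul, hzero, htrace,
          integral_inner_sub_mean_gaussian m _ hS]
        ring

/-- **Variance bound for Bonnet's gradient estimator** (Lemma C.4).
With stationarity of `q_* = N(m_*,Σ_*)` and any coupling `ψ` of `q = N(m,Σ)`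
and `q_*`:
`∫ ‖∇U(z) − ∫∇U dq_*‖² dq(z) ≤ 4L·∫ D_U dψ + 2dL`. -/
theorem bonnet_gradient_variance_bound
    (d : ℕ) (hd : 0 < d) (U : Vec d → ℝ) (μ L : ℝ) (hμ : 0 < μ) (hμL : μ ≤ L)
    (hU : ContDiff ℝ 2 U)
    (hconv : ∀ x : Vec d,
      (hess U x - μ • 1).PosSemidef ∧ ((L • (1 : Mat d)) - hess U x).PosSemidef)
    (m : Vec d) (S : Mat d) (hS : S.PosDef)
    (mstar : Vec d) (Sstar : Mat d) (hSstar : Sstar.PosDef)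
    (hstat1 : intGrad U (gaussian mstar Sstar) = 0)
    (hstat2 : intHess U (gaussian mstar Sstar) = Sstar⁻¹)
    (ψ : Measure (Vec d × Vec d))
    (hψ : IsCoupling ψ (gaussian m S) (gaussian mstar Sstar)) :
    (∫ z, ‖gradient U z - intGrad U (gaussian mstar Sstar)‖ ^ 2 ∂(gaussian m S))
      ≤ 4 * L * (∫ p, bregman U p.1 p.2 ∂ψ) + 2 * d * L := by
  have hL : 0 < L := hμ.trans_le hμL
  have hnorm : ∀ v : Vec d, v.ofLp ⬝ᵥ v.ofLp = ‖v‖ ^ 2 := fun v => by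
    rw [← real_inner_self_eq_norm_sq, EuclideanSpace.inner_eq_star_dotProduct]
    rfl
  have hlo : ∀ x v, 0 ≤ fderiv ℝ (fderiv ℝ U) x v v := fun x v => by
    have h := (hconv x).1.dotProduct_mulVec_nonneg v.ofLp
    rw [star_trivial, sub_mulVec, dotProduct_sub, smul_mulVec, one_mulVec, dotProduct_smul,
      hnorm, ← fderiv_fderiv_eq_dotProduct_hess hU, smul_eq_mul] at h
    have : 0 ≤ μ * ‖v‖ ^ 2 := by positivity
    linarith
  have hhi : ∀ x v, fderiv ℝ (fderiv ℝ U) x v v ≤ L * ‖v‖ ^ 2 := fun x v => by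
    have h := (hconv x).2.dotProduct_mulVec_nonneg v.ofLp
    rw [star_trivial, sub_mulVec, dotProduct_sub, smul_mulVec, one_mulVec, dotProduct_smul,
      hnorm, ← fderiv_fderiv_eq_dotProduct_hess hU, smul_eq_mul] at h
    linarith
  obtain ⟨hψp, hfst, hsnd⟩ := hψ
  have : IsProbabilityMeasure (gaussian mstar Sstar) :=
    hsnd ▸ Measure.isProbabilityMeasure_map measurable_snd.aemeasurable
  have hK := lipschitzWith_gradient hU hL hlo hhi
  have hgc := continuous_gradient hU
  have hgn : Continuous fun x => ‖gradient U x‖ ^ 2 := hgc.norm.pow 2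
  have hgrad : Integrable (fun p => ‖gradient U p.2‖ ^ 2) ψ := by
    have h := integrable_sq_norm_of_lipschitzWith (m := mstar) (a := 0) hSstar hK
    simp only [sub_zero] at h
    rw [← hsnd] at h
    exact h.comp_measurable measurable_snd
  have hx1 : Integrable (fun p => ‖p.1‖ ^ 2) ψ := by
    have h := integrable_sq_norm_of_lipschitzWith (m := m) (a := 0) hS LipschitzWith.id
    simp only [sub_zero] at h
    rw [← hfst] at h
    exact h.comp_measurable measurable_fst
  have hx2 : Integrable (fun p => ‖p.2‖ ^ 2) ψ := by
    have h := integrable_sq_norm_of_lipschitzWith (m := mstar) (a := 0) hSstar LipschitzWith.id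
    simp only [sub_zero] at h
    rw [← hsnd] at h
    exact h.comp_measurable measurable_snd
  have hbreg : Integrable (fun p => bregman U p.1 p.2) ψ := by
    refine ((hx1.add hx2).const_mul L).mono' (continuous_bregman hU).aestronglyMeasurable
      (Filter.Eventually.of_forall fun p => ?_)
    rw [Real.norm_of_nonneg (bregman_nonneg hU hlo _ _)]
    have h1 := bregman_le hU hhi p.1 p.2
    have h2 := parallelogram_law_with_norm ℝ p.1 p.2
    calc bregman U p.1 p.2 ≤ L / 2 * ‖p.1 - p.2‖ ^ 2 := h1
      _ ≤ L / 2 * (2 * (‖p.1‖ ^ 2 + ‖p.2‖ ^ 2)) := by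
        gcongr
        nlinarith [sq_nonneg ‖p.1 + p.2‖]
      _ = L * (‖p.1‖ ^ 2 + ‖p.2‖ ^ 2) := by ring
  have hstar : ∫ p, ‖gradient U p.2‖ ^ 2 ∂ψ ≤ L * d := by
    have h := integral_sq_norm_gradient_le hU hL hlo hhi hSstar hstat1 hstat2
    rwa [← hsnd, integral_map measurable_snd.aemeasurable
      hgn.aestronglyMeasurable] at h
  rw [hstat1]
  simp only [sub_zero]
  rw [← hfst, integral_map measurable_fst.aemeasurable hgn.aestronglyMeasurable]
  calc ∫ p, ‖gradient U p.1‖ ^ 2 ∂ψ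
      ≤ ∫ p, (4 * L * bregman U p.1 p.2 + 2 * ‖gradient U p.2‖ ^ 2) ∂ψ := by
        refine integral_mono_of_nonneg (Filter.Eventually.of_forall fun p => by positivity)
          ((hbreg.const_mul (4 * L)).add (hgrad.const_mul 2))
          (Filter.Eventually.of_forall fun p => ?_)
        have h1 := sq_norm_gradient_sub_le hU hL hlo hhi p.1 p.2
        have h2 := norm_le_norm_sub_add (gradient U p.1) (gradient U p.2)
        have h3 : ‖gradient U p.1‖ ^ 2 ≤
            (‖gradient U p.1 - gradient U p.2‖ + ‖gradient U p.2‖) ^ 2 := by gcongr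
        have h4 := add_sq_le (a := ‖gradient U p.1 - gradient U p.2‖) (b := ‖gradient U p.2‖)
        simp only
        linarith
    _ = 4 * L * (∫ p, bregman U p.1 p.2 ∂ψ) + 2 * ∫ p, ‖gradient U p.2‖ ^ 2 ∂ψ := by
        rw [integral_add (hbreg.const_mul (4 * L)) (hgrad.const_mul 2), integral_const_mul,
          integral_const_mul]
    _ ≤ _ := by linarith
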